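/- (Fano-type lemma for possibly stochastic decoders.) Let (U, V) = {(U_n, V_n)}_{n≥1} be a sequence of pairs of random variables with U_n taking values in a finite alphabet. If there is a sequence {Ψ_n}_{n≥1} of possibly stochastic functions, where for each n the randomness of Ψ_n is independent of (U_n, V_n), satisfying lim_{n→∞} P(Ψ_n(V_n) ≠ U_n) = 0, then H̄(U|V) = 0. -/

import Mathlib

/-!
Statement 10 (Fano-type lemma for possibly stochastic decoders):
if Ψ_n is a (possibly stochastic) function of V_n, independent of (U_n, V_n),
with P(Ψ_n(V_n) ≠ U_n) → 0, then H̄(U|V) = 0.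

A stochastic function is modelled as a random deterministic function
`g : β n → α n` drawn according to a distribution `ρ n`, independently of
`(U_n, V_n)`.
-/

open Filter
open scoped ENNReal Classical

noncomputable section

/-- Probability of a set of outcomes under a probability mass function. -/
def prw {Ω : Type*} (μ : Ω → ℝ≥0∞) (A : Set Ω) : ℝ≥0∞ := ∑' ω, A.indicator μ ω

/-- Limit superior in probability of a sequence of real random variables. -/
def pLimsup {Ω : ℕ → Type*} (μ : ∀ n, Ω n → ℝ≥0∞) (f : ∀ n, Ω n → ℝ) : ℝ :=
  sInf {θ : ℝ | Tendsto (fun n => prw (μ n) {ω | θ < f n ω}) atTop (nhds 0)}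

/-- Conditional probability `μ_{U|V}(u|v)`. -/
def condProbEq {Ω α β : Type*} (μ : Ω → ℝ≥0∞) (U : Ω → α) (V : Ω → β)
    (u : α) (v : β) : ℝ≥0∞ :=
  prw μ {ω | U ω = u ∧ V ω = v} / prw μ {ω | V ω = v}

/-- Spectral conditional sup-entropy rate `H̄(U|V)`. -/
def condSupEntropyRate {Ω α β : ℕ → Type*} (μ : ∀ n, Ω n → ℝ≥0∞)
    (U : ∀ n, Ω n → α n) (V : ∀ n, Ω n → β n) : ℝ :=
  pLimsup μ fun n ω =>
    (n : ℝ)⁻¹ *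
      Real.logb 2 ((condProbEq (μ n) (U n) (V n) (U n ω) (V n ω)).toReal)⁻¹

open Topology

lemma prw_singleton_eq {α β : Type*} (μ : α × β → ℝ≥0∞) (ω : α × β) :
    prw μ {x | x.1 = ω.1 ∧ x.2 = ω.2} = μ ω := by
  have h : {x : α × β | x.1 = ω.1 ∧ x.2 = ω.2} = {ω} := by
    ext x
    simp [Prod.ext_iff]
  rw [h, prw, tsum_eq_single ω]
  · simp
  · intro x hx
    simp [hx]

lemma prw_snd_eq {α β : Type*} (μ : α × β → ℝ≥0∞) (v : β) :
    prw μ {x | x.2 = v} = ∑' u, μ (u, v) := by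
  rw [prw, ENNReal.tsum_prod']
  refine tsum_congr fun u => ?_
  rw [tsum_eq_single v]
  · simp
  · intro b hb
    simp [hb]

lemma condProbEq_le_one {α β : Type*} (μ : α × β → ℝ≥0∞) (ω : α × β) :
    condProbEq μ Prod.fst Prod.snd ω.1 ω.2 ≤ 1 := by
  rw [condProbEq, prw_singleton_eq, prw_snd_eq]
  refine ENNReal.div_le_of_le_mul ?_
  rw [one_mul]
  exact ENNReal.le_tsum (f := fun u => μ (u, ω.2)) ω.1

/-- The conditional self-information `log₂ (1 / μ_{U|V})` is nonnegative. -/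
lemma logb_inv_condProbEq_nonneg {α β : Type*} (μ : α × β → ℝ≥0∞) (ω : α × β) :
    0 ≤ Real.logb 2 ((condProbEq μ Prod.fst Prod.snd ω.1 ω.2).toReal)⁻¹ := by
  have h1 : (condProbEq μ Prod.fst Prod.snd ω.1 ω.2).toReal ≤ 1 :=
    ENNReal.toReal_le_of_le_ofReal zero_le_one (by simpa using condProbEq_le_one μ ω)
  rw [Real.logb_inv, neg_nonneg]
  exact Real.logb_nonpos one_lt_two ENNReal.toReal_nonneg h1

/-- If the self-information exceeds `nθ`, the conditional probability is at most `2 ^ (-nθ)`. -/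
lemma le_rpow_mul_of_lt_logb {α β : Type*} (μ : α × β → ℝ≥0∞) (ω : α × β) {c : ℝ} (hc : 0 ≤ c)
    (h : c < Real.logb 2 ((condProbEq μ Prod.fst Prod.snd ω.1 ω.2).toReal)⁻¹) :
    μ ω ≤ ENNReal.ofReal ((2 : ℝ) ^ (-c)) * ∑' u, μ (u, ω.2) := by
  have ht : 0 < (2 : ℝ) ^ (-c) := Real.rpow_pos_of_pos two_pos _
  set p := condProbEq μ Prod.fst Prod.snd ω.1 ω.2 with hp
  have hp0 : p.toReal ≠ 0 := by
    intro h0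
    rw [h0] at h
    simp at h
    linarith
  have hpos : 0 < p.toReal := lt_of_le_of_ne ENNReal.toReal_nonneg hp0.symm
  have hlt : p.toReal ≤ (2 : ℝ) ^ (-c) := by
    rw [Real.logb_inv, lt_neg] at h
    exact ((Real.logb_lt_iff_lt_rpow one_lt_two hpos).1 h).le
  have hle : p ≤ ENNReal.ofReal ((2 : ℝ) ^ (-c)) :=
    (ENNReal.le_ofReal_iff_toReal_le (ne_top_of_le_ne_top ENNReal.one_ne_top
      (condProbEq_le_one μ ω)) ht.le).2 hlt
  rw [hp, condProbEq, prw_singleton_eq, prw_snd_eq] at hle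
  exact (ENNReal.div_le_iff_le_mul (Or.inr ENNReal.ofReal_ne_top)
    (Or.inr (by simpa using ht))).1 hle

/-- An event on which `μ_{U|V} ≤ t` has probability at most `t` plus the error probability of any
stochastic decoder. -/
lemma prw_le_add_error {α β : Type*} (μ : α × β → ℝ≥0∞) (hμ : ∑' ω, μ ω = 1)
    (ρ : (β → α) → ℝ≥0∞) (hρ : ∑' g, ρ g = 1) (t : ℝ≥0∞) (A : Set (α × β))
    (hA : ∀ ω ∈ A, μ ω ≤ t * ∑' u, μ (u, ω.2)) :
    prw μ A ≤ t + ∑' (ω : α × β) (g : β → α),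
      μ ω * ρ g * (if g ω.2 ≠ ω.1 then 1 else 0) := by
  have hcorrect : ∑' (ω : α × β) (g : β → α),
      (t * ∑' u, μ (u, ω.2)) * ρ g * (if g ω.2 = ω.1 then 1 else 0) = t := by
    have hg (g : β → α) : ∑' ω : α × β,
        (t * ∑' u, μ (u, ω.2)) * ρ g * (if g ω.2 = ω.1 then 1 else 0) = t * ρ g := by
      rw [ENNReal.tsum_prod', ENNReal.tsum_comm]
      have hv (v : β) : ∑' u : α, (t * ∑' u', μ (u', v)) * ρ g * (if g v = u then 1 else 0)
          = t * ρ g * ∑' u', μ (u', v) := by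
        rw [tsum_eq_single (g v)]
        · simp only [if_true, mul_one]
          ring
        · intro u hu
          simp [hu.symm]
      simp only [hv]
      rw [ENNReal.tsum_mul_left, ENNReal.tsum_comm, ← ENNReal.tsum_prod',
        hμ, mul_one]
    rw [ENNReal.tsum_comm]
    simp only [hg]
    rw [ENNReal.tsum_mul_left, hρ, mul_one]
  calc prw μ A = ∑' (ω : α × β) (g : β → α), A.indicator μ ω * ρ g := by
        simp only [ENNReal.tsum_mul_left, hρ, mul_one]
        rfl
    _ ≤ ∑' (ω : α × β) (g : β → α),
          ((t * ∑' u, μ (u, ω.2)) * ρ g * (if g ω.2 = ω.1 then 1 else 0)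
            + μ ω * ρ g * (if g ω.2 ≠ ω.1 then 1 else 0)) := by
        refine ENNReal.tsum_le_tsum fun ω => ENNReal.tsum_le_tsum fun g => ?_
        by_cases hω : ω ∈ A
        · rw [Set.indicator_of_mem hω]
          by_cases h : g ω.2 = ω.1
          · simpa [h] using mul_le_mul_left (hA ω hω) (ρ g)
          · simp [h]
        · simp [hω]
    _ = _ := by
        simp only [ENNReal.tsum_add]
        rw [hcorrect]

lemma tendsto_ofReal_two_rpow_neg_mul {θ : ℝ} (hθ : 0 < θ) :
    Tendsto (fun n : ℕ => ENNReal.ofReal ((2 : ℝ) ^ (-(n * θ)))) atTop (𝓝 0) := by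
  rw [← ENNReal.ofReal_zero]
  refine ENNReal.tendsto_ofReal ?_
  have hbase : (2 : ℝ) ^ (-θ) < 1 :=
    Real.rpow_lt_one_of_one_lt_of_neg one_lt_two (neg_neg_of_pos hθ)
  refine (tendsto_pow_atTop_nhds_zero_of_lt_one (by positivity) hbase).congr fun n => ?_
  rw [← Real.rpow_mul_natCast two_pos.le]
  congr 1
  ring

/-- Fano-type lemma: if there is a sequence `Ψ_n` of possibly
stochastic functions, with randomness independent of `(U_n, V_n)`, such that
`P(Ψ_n(V_n) ≠ U_n) → 0`, then `H̄(U|V) = 0`. -/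
theorem condSupEntropyRate_eq_zero_of_decodable
    (α β : ℕ → Type*) [∀ n, Fintype (α n)]
    (μ : ∀ n, α n × β n → ℝ≥0∞) (hμ : ∀ n, ∑' ω, μ n ω = 1)
    (ρ : ∀ n, (β n → α n) → ℝ≥0∞) (hρ : ∀ n, ∑' g, ρ n g = 1)
    (herr :
      Tendsto
        (fun n => ∑' (ω : α n × β n) (g : β n → α n),
          μ n ω * ρ n g * (if g ω.2 ≠ ω.1 then 1 else 0))
        atTop (nhds 0)) :
    condSupEntropyRate μ (fun n => Prod.fst) (fun n => Prod.snd) = 0 := by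
  have hpos {θ : ℝ} (hθ : 0 < θ) : θ ∈ {θ : ℝ | Tendsto (fun n => prw (μ n) {ω | θ <
      (n : ℝ)⁻¹ * Real.logb 2 ((condProbEq (μ n) Prod.fst Prod.snd ω.1 ω.2).toReal)⁻¹})
      atTop (𝓝 0)} := by
    have hlim := (tendsto_ofReal_two_rpow_neg_mul hθ).add herr
    rw [add_zero] at hlim
    refine tendsto_of_tendsto_of_tendsto_of_le_of_le' tendsto_const_nhds hlim
      (Eventually.of_forall fun _ => zero_le) ?_
    filter_upwards [eventually_gt_atTop 0] with n hn
    have hn' : (0 : ℝ) < n := Nat.cast_pos.2 hn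
    refine prw_le_add_error (μ n) (hμ n) (ρ n) (hρ n) _ _ fun ω hω => ?_
    refine le_rpow_mul_of_lt_logb (μ n) ω (by positivity) ?_
    rwa [Set.mem_ofPred_eq, lt_inv_mul_iff₀ hn'] at hω
  refine IsGLB.csInf_eq ⟨fun θ hθ => ?_, fun b hb => ?_⟩ ⟨1, hpos one_pos⟩
  · by_contra! hneg
    have hone (n : ℕ) : prw (μ n) {ω | θ < (n : ℝ)⁻¹ *
        Real.logb 2 ((condProbEq (μ n) Prod.fst Prod.snd ω.1 ω.2).toReal)⁻¹} = 1 := by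
      have huniv : {ω : α n × β n | θ < (n : ℝ)⁻¹ *
          Real.logb 2 ((condProbEq (μ n) Prod.fst Prod.snd ω.1 ω.2).toReal)⁻¹} = Set.univ :=
        Set.eq_univ_of_forall fun ω => hneg.trans_le
          (mul_nonneg (by positivity) (logb_inv_condProbEq_nonneg (μ n) ω))
      rw [huniv, prw, Set.indicator_univ, hμ n]
    rw [Set.mem_ofPred_eq] at hθ
    exact one_ne_zero (tendsto_nhds_unique (tendsto_const_nhds.congr fun n => (hone n).symm) hθ)
  · exact le_of_forall_pos_le_add fun ε hε => by simpa using hb (hpos hε)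

end
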